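/- arXiv:2404.10418 — 2 statements merged into one kernel-verified Lean document; each statement's English description precedes it below -/
import Mathlib

section
/- Let q ≥ 3, 1 ≤ d′ ≤ d ≤ n with d′ + d ≤ n + 1, and let f : (ℤ_q)^n → {−1,1} be a Boolean function whose Fourier coefficients f̂(u) vanish unless |u| = 0 or d′ ≤ |u| ≤ d. Then f has at most (d/2) · q^{d+d′} / (2^{d′}(q−1)^{d′}) relevant variables. -/
open Finset BigOperators
open scoped Classical

/-- The character `χ_u(x) = ω^{⟨u,x⟩}` on `(ℤ_q)^n`, with `ω = e^{2πi/q}`. -/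
noncomputable def chi (q n : ℕ) (u x : Fin n → ZMod q) : ℂ :=
  Complex.exp (2 * Real.pi * Complex.I * (((∑ i, u i * x i).val : ℕ) : ℂ) / q)

/-- Fourier coefficient `f̂(u) = q^{-n} Σ_x f(x) conj(χ_u(x))`. -/
noncomputable def fhat (q n : ℕ) [NeZero q] (f : (Fin n → ZMod q) → ℂ)
    (u : Fin n → ZMod q) : ℂ :=
  (1 / (q : ℂ) ^ n) * ∑ x, f x * (starRingEnd ℂ) (chi q n u x)

/-- Adjacency operator of the Hamming graph `H(n,q)`. -/
noncomputable def adjOp (q n : ℕ) [NeZero q] (f : (Fin n → ZMod q) → ℂ)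
    (x : Fin n → ZMod q) : ℂ :=
  ∑ y ∈ univ.filter (fun y => hammingDist x y = 1), f y

/-- Twice the number of edges `{x,y}` of `H(n,q)` with `f x ≠ f y`
(the number of ordered such pairs). -/
noncomputable def nuOrd (q n : ℕ) [NeZero q] {α : Type*} (f : (Fin n → ZMod q) → α) : ℕ :=
  (univ.filter (fun p : (Fin n → ZMod q) × (Fin n → ZMod q) =>
    hammingDist p.1 p.2 = 1 ∧ f p.1 ≠ f p.2)).card

/-- Coordinate `i` is relevant for `f`. -/
def Relevant {q n : ℕ} {α : Type*} (f : (Fin n → ZMod q) → α) (i : Fin n) : Prop :=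
  ∃ x y : Fin n → ZMod q, (∀ j, j ≠ i → x j = y j) ∧ f x ≠ f y

/-- The function `f_{i,a,b}` on `(ℤ_q)^n` obtained from `f` on `(ℤ_q)^{n+1}`. -/
noncomputable def restrictDiff {q n : ℕ} (f : (Fin (n + 1) → ZMod q) → ℂ)
    (i : Fin (n + 1)) (a b : ZMod q) : (Fin n → ZMod q) → ℂ :=
  fun y => f (i.insertNth a y) - f (i.insertNth b y)

/-- The size of the support of `g`. -/
noncomputable def suppCard (q n : ℕ) [NeZero q] (g : (Fin n → ZMod q) → ℂ) : ℕ :=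
  (univ.filter (fun y => g y ≠ 0)).card


section helpers

lemma chi_eq (q n : ℕ) [NeZero q] (u x : Fin n → ZMod q) :
    chi q n u x = ZMod.stdAddChar (∑ i, u i * x i) := by
  rw [chi, ZMod.stdAddChar_apply, ZMod.toCircle_apply]

lemma conj_chi (q n : ℕ) [NeZero q] (u x : Fin n → ZMod q) :
    (starRingEnd ℂ) (chi q n u x) = ZMod.stdAddChar (-∑ i, u i * x i) := by
  rw [chi_eq, AddChar.map_neg_eq_conj]

/-- Slice of `f` at coordinate `r` with value `k`. -/
def slc {q n : ℕ} (f : (Fin (n + 1) → ZMod q) → ℂ) (r : Fin (n + 1)) (k : ZMod q) :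
    (Fin n → ZMod q) → ℂ := fun y => f (r.insertNth k y)

lemma sum_insertNth {q n : ℕ} [NeZero q] {M : Type*} [AddCommMonoid M] (r : Fin (n + 1))
    (g : (Fin (n + 1) → ZMod q) → M) :
    ∑ x, g x = ∑ k : ZMod q, ∑ y : Fin n → ZMod q, g (r.insertNth k y) := by
  rw [← Fintype.sum_prod_type' (f := fun k (y : Fin n → ZMod q) => g (r.insertNth k y))]
  exact (Equiv.sum_comp (Fin.insertNthEquiv (fun _ => ZMod q) r) g).symm

lemma fhat_insertNth (q n : ℕ) [NeZero q] (f : (Fin (n + 1) → ZMod q) → ℂ)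
    (r : Fin (n + 1)) (a : ZMod q) (v : Fin n → ZMod q) :
    fhat q (n + 1) f (r.insertNth a v)
      = (1 / (q : ℂ)) * ZMod.dft (fun k => fhat q n (slc f r k) v) a := by
  rw [fhat, sum_insertNth r, ZMod.dft_apply, pow_succ', Finset.mul_sum, Finset.mul_sum]
  refine Finset.sum_congr rfl fun k _ => ?_
  rw [fhat, smul_eq_mul, Finset.mul_sum, Finset.mul_sum, Finset.mul_sum, Finset.mul_sum]
  refine Finset.sum_congr rfl fun y _ => ?_
  rw [conj_chi, conj_chi, Fin.sum_univ_succAbove _ r]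
  simp only [Fin.insertNth_apply_same, Fin.insertNth_apply_succAbove, slc]
  rw [neg_add, AddChar.map_add_eq_mul, mul_comm a k]
  field_simp

lemma fhat_slice_exists (q n : ℕ) [NeZero q] (f : (Fin (n + 1) → ZMod q) → ℂ)
    (r : Fin (n + 1)) (k : ZMod q) (v : Fin n → ZMod q) (h : fhat q n (slc f r k) v ≠ 0) :
    ∃ a, fhat q (n + 1) f (r.insertNth a v) ≠ 0 := by
  by_contra! hc
  have hq : (q : ℂ) ≠ 0 := by exact_mod_cast NeZero.ne q
  have h0 : ZMod.dft (fun k => fhat q n (slc f r k) v) = 0 := by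
    funext a
    have := hc a
    rw [fhat_insertNth] at this
    simpa [hq] using this
  rw [LinearEquiv.map_eq_zero_iff] at h0
  exact h (congrFun h0 k)

lemma fhat_sub (q n : ℕ) [NeZero q] (f g : (Fin n → ZMod q) → ℂ) (u : Fin n → ZMod q) :
    fhat q n (f - g) u = fhat q n f u - fhat q n g u := by
  simp [fhat, sub_mul, mul_sub]

lemma fhat_slice_sub_exists (q n : ℕ) [NeZero q] (f : (Fin (n + 1) → ZMod q) → ℂ)
    (r : Fin (n + 1)) (k m : ZMod q) (v : Fin n → ZMod q)
    (h : fhat q n (slc f r k - slc f r m) v ≠ 0) :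
    ∃ a, a ≠ 0 ∧ fhat q (n + 1) f (r.insertNth a v) ≠ 0 := by
  by_contra! hc
  have hq : (q : ℂ) ≠ 0 := by exact_mod_cast NeZero.ne q
  have h0 : ∀ a, a ≠ 0 → ZMod.dft (fun k => fhat q n (slc f r k) v) a = 0 := by
    intro a ha
    have := hc a ha
    rw [fhat_insertNth] at this
    simpa [hq] using this
  have key : ∀ k, fhat q n (slc f r k) v
      = (q : ℂ)⁻¹ * ZMod.dft (fun k => fhat q n (slc f r k) v) 0 := by
    intro k
    have := congrFun (ZMod.dft.symm_apply_apply (fun k => fhat q n (slc f r k) v)) k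
    rw [ZMod.invDFT_apply, Finset.sum_eq_single 0] at this
    · simpa using this.symm
    · intro b _ hb
      rw [h0 b hb, smul_zero]
    · simp
  rw [fhat_sub, key k, key m, sub_self] at h
  exact h rfl

lemma fhat_slice_sum (q n : ℕ) [NeZero q] (f : (Fin (n + 1) → ZMod q) → ℂ)
    (r : Fin (n + 1)) (v : Fin n → ZMod q) :
    fhat q (n + 1) f (r.insertNth 0 v) = (1 / (q : ℂ)) * ∑ k, fhat q n (slc f r k) v := by
  rw [fhat_insertNth, ZMod.dft_apply_zero]

lemma hammingNorm_insertNth (q n : ℕ) [NeZero q] (r : Fin (n + 1)) (a : ZMod q)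
    (v : Fin n → ZMod q) :
    hammingNorm (r.insertNth a v : Fin (n + 1) → ZMod q)
      = (if a ≠ 0 then 1 else 0) + hammingNorm v := by
  simp only [hammingNorm, Finset.card_filter]
  rw [Fin.sum_univ_succAbove _ r]
  simp

lemma addChar_sum {A ι : Type*} [AddCommGroup A] (ψ : AddChar A ℂ) (s : Finset ι) (g : ι → A) :
    ψ (∑ i ∈ s, g i) = ∏ i ∈ s, ψ (g i) := by
  induction s using Finset.induction_on with
  | empty => simp
  | insert a s ha ih => rw [Finset.sum_insert ha, Finset.prod_insert ha, AddChar.map_add_eq_mul, ih]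

lemma sum_chi (q n : ℕ) [NeZero q] (z : Fin n → ZMod q) :
    ∑ u : Fin n → ZMod q, (ZMod.stdAddChar (∑ i, u i * z i) : ℂ)
      = if z = 0 then (q : ℂ) ^ n else 0 := by
  have h1 : ∀ u : Fin n → ZMod q, (ZMod.stdAddChar (∑ i, u i * z i) : ℂ)
      = ∏ i, (ZMod.stdAddChar (u i * z i) : ℂ) := fun u => by
    exact addChar_sum _ _ _
  simp only [h1]
  rw [← Fintype.prod_sum (fun i a => (ZMod.stdAddChar (a * z i) : ℂ))]
  simp only [AddChar.sum_mulShift _ (ZMod.isPrimitive_stdAddChar q)]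
  split_ifs with h
  · subst h; simp
  · obtain ⟨i, hi⟩ := Function.ne_iff.1 h
    refine Finset.prod_eq_zero (mem_univ i) ?_
    simp only [Pi.zero_apply] at hi
    simp [hi]

lemma parseval (q n : ℕ) [NeZero q] (f : (Fin n → ZMod q) → ℂ) :
    ∑ u, ‖fhat q n f u‖ ^ 2 = (1 / (q : ℝ) ^ n) * ∑ x, ‖f x‖ ^ 2 := by
  have hq : (q : ℂ) ≠ 0 := by exact_mod_cast NeZero.ne q
  have hc : ∀ z : ℂ, ((‖z‖ ^ 2 : ℝ) : ℂ) = z * (starRingEnd ℂ) z := fun z => by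
    rw [Complex.mul_conj, Complex.normSq_eq_norm_sq]
  apply Complex.ofReal_injective
  rw [Complex.ofReal_sum, Complex.ofReal_mul, Complex.ofReal_sum]
  simp only [hc]
  have e1 : ∀ u, fhat q n f u * (starRingEnd ℂ) (fhat q n f u)
      = ∑ x, ∑ y, (1 / (q : ℂ) ^ n) ^ 2 * (f x * (starRingEnd ℂ) (f y)) *
          (ZMod.stdAddChar (∑ i, u i * (y - x) i) : ℂ) := by
    intro u
    rw [fhat, map_mul, map_sum, mul_mul_mul_comm, Finset.sum_mul_sum, Finset.mul_sum]
    refine Finset.sum_congr rfl fun x _ => ?_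
    rw [Finset.mul_sum]
    refine Finset.sum_congr rfl fun y _ => ?_
    rw [map_mul, Complex.conj_conj, conj_chi, chi_eq]
    have : ∑ i, u i * (y - x) i = -∑ i, u i * x i + ∑ i, u i * y i := by
      simp [mul_sub]; ring
    rw [this, AddChar.map_add_eq_mul]
    simp
    ring
  simp only [e1]
  rw [Finset.sum_comm, Finset.mul_sum]
  refine Finset.sum_congr rfl fun x _ => ?_
  rw [Finset.sum_comm]
  simp only [← Finset.mul_sum, sum_chi, sub_eq_zero]
  simp
  field_simp

lemma exists_fhat_ne_zero (q n : ℕ) [NeZero q] (f : (Fin n → ZMod q) → ℂ) (hf : f ≠ 0) :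
    ∃ u, fhat q n f u ≠ 0 := by
  by_contra! h
  have hq : (q : ℝ) ≠ 0 := by exact_mod_cast NeZero.ne q
  have := parseval q n f
  simp only [h] at this
  have h2 : ∑ x, ‖f x‖ ^ 2 = 0 := by
    simpa [hq] using this
  rw [Finset.sum_eq_zero_iff_of_nonneg (fun _ _ => by positivity)] at h2
  apply hf
  funext x
  simpa using h2 x (mem_univ x)

lemma fhat_shift (q n : ℕ) [NeZero q] (f : (Fin n → ZMod q) → ℂ) (i : Fin n) (c : ZMod q)
    (u : Fin n → ZMod q) :
    fhat q n (fun x => f (x + Pi.single i c)) u = ZMod.stdAddChar (u i * c) * fhat q n f u := by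
  rw [fhat, fhat, ← Equiv.sum_comp (Equiv.addRight (Pi.single i c))
    (fun x => f x * (starRingEnd ℂ) (chi q n u x)), mul_left_comm]
  congr 1
  rw [Finset.mul_sum]
  refine Finset.sum_congr rfl fun x _ => ?_
  simp only [Equiv.coe_addRight, conj_chi]
  rw [mul_left_comm, ← AddChar.map_add_eq_mul]
  congr 2
  simp [mul_add, Finset.sum_add_distrib, Pi.single_apply]

lemma sum_norm_one_sub (q : ℕ) [NeZero q] (a : ZMod q) :
    ∑ c : ZMod q, ‖(1 : ℂ) - ZMod.stdAddChar (a * c)‖ ^ 2 = if a ≠ 0 then 2 * (q : ℝ) else 0 := by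
  have h1 : ∀ c : ZMod q, ‖(1 : ℂ) - ZMod.stdAddChar (a * c)‖ ^ 2
      = 2 - 2 * (ZMod.stdAddChar (c * a) : ℂ).re := by
    intro c
    have h2 : ‖(ZMod.stdAddChar (a * c) : ℂ)‖ = 1 := AddChar.norm_apply _ _
    rw [mul_comm c a]
    generalize (ZMod.stdAddChar (a * c) : ℂ) = z at *
    have h3 : ‖z‖ ^ 2 = 1 := by rw [h2]; norm_num
    rw [← Complex.normSq_eq_norm_sq, Complex.normSq_apply] at *
    simp
    nlinarith
  simp only [h1]
  rw [Finset.sum_sub_distrib, ← Finset.mul_sum, ← Complex.re_sum,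
    AddChar.sum_mulShift _ (ZMod.isPrimitive_stdAddChar q)]
  by_cases h : a = 0
  · simp [h]; ring
  · simp [h]; ring

/-- Influence identity. -/
lemma energy (q n : ℕ) [NeZero q] (f : (Fin n → ZMod q) → ℂ) (i : Fin n) :
    ∑ c : ZMod q, ∑ x, ‖f x - f (x + Pi.single i c)‖ ^ 2
      = (q : ℝ) ^ n * ∑ u, (if u i ≠ 0 then 2 * (q : ℝ) else 0) * ‖fhat q n f u‖ ^ 2 := by
  have hq : (q : ℝ) ≠ 0 := by exact_mod_cast NeZero.ne q
  have h1 : ∀ c : ZMod q, ∑ x, ‖f x - f (x + Pi.single i c)‖ ^ 2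
      = (q : ℝ) ^ n * ∑ u, ‖(1 : ℂ) - ZMod.stdAddChar (u i * c)‖ ^ 2 * ‖fhat q n f u‖ ^ 2 := by
    intro c
    have := parseval q n (f - fun x => f (x + Pi.single i c))
    simp only [fhat_sub, fhat_shift, Pi.sub_apply] at this
    have h2 : ∀ u, fhat q n f u - ZMod.stdAddChar (u i * c) * fhat q n f u
        = (1 - ZMod.stdAddChar (u i * c)) * fhat q n f u := fun u => by ring
    simp only [h2, norm_mul, mul_pow] at this
    rw [this]
    field_simp
  simp only [h1]
  rw [← Finset.mul_sum, Finset.sum_comm]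
  simp only [← Finset.sum_mul, sum_norm_one_sub]

end helpers

section support

/-- Fourier support in weights `[i,j]`. -/
def Spec (q n i j : ℕ) [NeZero q] (f : (Fin n → ZMod q) → ℂ) : Prop :=
  ∀ u, fhat q n f u ≠ 0 → i ≤ hammingNorm u ∧ hammingNorm u ≤ j

lemma comb_star {ι X : Type*} [Fintype ι] (F : ι → X) (s : ι → ℝ) (q : ℕ) (hq : 3 ≤ q)
    (hcard : Fintype.card ι = q) (hs : ∀ k, 0 ≤ s k) (C : ℝ) (hC : 0 ≤ C)
    (hcross : ∀ k m, F k ≠ F m → q * C ≤ s k + s m) (k m : ι) (hkm : F k ≠ F m) :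
    (2 * ((q : ℝ) - 1) * C ≤ ∑ l, s l) ∨ ∃ k0, ∀ l, l ≠ k0 → ∀ l', l' ≠ k0 → F l = F l' := by
  have hqR : (3 : ℝ) ≤ q := by exact_mod_cast hq
  have four : ∀ a b c d : ι, a ≠ b → a ≠ c → a ≠ d → b ≠ c → b ≠ d → c ≠ d →
      F a ≠ F b → F c ≠ F d → 2 * ((q : ℝ) - 1) * C ≤ ∑ l, s l := by
    intro a b c d h1 h2 h3 h4 h5 h6 hab hcd
    have hle : ∑ l ∈ ({a, b, c, d} : Finset ι), s l ≤ ∑ l, s l :=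
      Finset.sum_le_sum_of_subset_of_nonneg (subset_univ _) (fun i _ _ => hs i)
    rw [Finset.sum_insert (by simp [h1, h2, h3]), Finset.sum_insert (by simp [h4, h5]),
      Finset.sum_insert (by simp [h6]), Finset.sum_singleton] at hle
    have := hcross a b hab
    have := hcross c d hcd
    nlinarith
  have hne : k ≠ m := fun h => hkm (h ▸ rfl)
  by_cases h1 : ∃ c d, c ≠ k ∧ c ≠ m ∧ d ≠ k ∧ d ≠ m ∧ F c ≠ F d
  · obtain ⟨c, d, hck, hcm, hdk, hdm, hcd⟩ := h1
    left
    exact four k m c d hne hck.symm hdk.symm hcm.symm hdm.symm (fun h => hcd (h ▸ rfl)) hkm hcd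
  push Not at h1
  obtain ⟨l, hl⟩ : ∃ l, l ∉ ({k, m} : Finset ι) := by
    by_contra! hc
    have : Fintype.card ι ≤ 2 := by
      rw [← Finset.card_univ]
      exact (Finset.card_le_card (fun x _ => hc x)).trans Finset.card_le_two
    omega
  simp only [Finset.mem_insert, Finset.mem_singleton, not_or] at hl
  obtain ⟨hlk, hlm⟩ : l ≠ k ∧ l ≠ m := hl
  have hall : ∀ x, x ≠ k → x ≠ m → F x = F l := fun x h2 h3 => h1 x l h2 h3 hlk hlm
  by_cases hk : F k = F l
  · right
    refine ⟨m, ?_⟩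
    have : ∀ x, x ≠ m → F x = F l := fun x hx => by
      by_cases hxk : x = k
      · rw [hxk, hk]
      · exact hall x hxk hx
    intro a ha b hb
    rw [this a ha, this b hb]
  by_cases hm : F m = F l
  · right
    refine ⟨k, ?_⟩
    have : ∀ x, x ≠ k → F x = F l := fun x hx => by
      by_cases hxk : x = m
      · rw [hxk, hm]
      · exact hall x hx hxk
    intro a ha b hb
    rw [this a ha, this b hb]
  left
  by_cases h4 : ∃ l', l' ≠ k ∧ l' ≠ m ∧ l' ≠ l
  · obtain ⟨l', h5, h6, h7⟩ := h4
    exact four k l m l' hlk.symm hne h5.symm hlm h7.symm h6.symm hk (by rw [hall l' h5 h6]; exact hm)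
  · push Not at h4
    have hq3 : q = 3 := by
      have : Fintype.card ι ≤ 3 := by
        rw [← Finset.card_univ]
        refine (Finset.card_le_card (t := {k, m, l}) (fun x _ => ?_)).trans Finset.card_le_three
        by_cases hx : x = k
        · simp [hx]
        by_cases hx' : x = m
        · simp [hx']
        · simp [h4 x hx hx']
      omega
    have hle : ∑ x ∈ ({k, m, l} : Finset ι), s x ≤ ∑ x, s x :=
      Finset.sum_le_sum_of_subset_of_nonneg (subset_univ _) (fun i _ _ => hs i)
    rw [Finset.sum_insert (by simp [hne, hlk.symm]), Finset.sum_insert (by simp [hlm.symm]),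
      Finset.sum_singleton] at hle
    have e1 := hcross k m hkm
    have e2 := hcross k l hk
    have e3 := hcross m l hm
    rw [hq3] at e1 e2 e3 ⊢
    push_cast at *
    linarith

lemma suppCard_slices (q n : ℕ) [NeZero q] (f : (Fin (n + 1) → ZMod q) → ℂ) (r : Fin (n + 1)) :
    (suppCard q (n + 1) f : ℝ) = ∑ k, (suppCard q n (slc f r k) : ℝ) := by
  rw [← Nat.cast_sum]
  congr 1
  simp only [suppCard, Finset.card_filter]
  rw [sum_insertNth r]
  rfl

lemma suppCard_sub (q n : ℕ) [NeZero q] (f g : (Fin n → ZMod q) → ℂ) :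
    (suppCard q n (f - g) : ℝ) ≤ suppCard q n f + suppCard q n g := by
  rw [← Nat.cast_add, Nat.cast_le]
  simp only [suppCard]
  refine le_trans (Finset.card_le_card ?_) (Finset.card_union_le _ _)
  intro x
  simp only [mem_filter, mem_univ, true_and, mem_union, Pi.sub_apply]
  intro h
  by_contra! hc
  exact h (by rw [hc.1, hc.2, sub_zero])

lemma const_of_slices {q n : ℕ} (f : (Fin (n + 1) → ZMod q) → ℂ)
    (h : ∀ r k m, slc f r k = slc f r m) (x y : Fin (n + 1) → ZMod q) : f x = f y := by
  have hu : ∀ r z a, f (Function.update z r a) = f z := by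
    intro r z a
    have := congrFun (h r a (z r)) (r.removeNth z)
    simpa [slc, Fin.insertNth_removeNth] using this
  have : ∀ S : Finset (Fin (n + 1)), f (S.piecewise y x) = f x := by
    intro S
    induction S using Finset.induction_on with
    | empty => simp
    | insert a s ha ih => rw [Finset.piecewise_insert, hu, ih]
  simpa using (this univ).symm

theorem supp_bound (q : ℕ) [NeZero q] (hq : 3 ≤ q) : ∀ n i j e : ℕ, n = i + j + e →
    ∀ f : (Fin n → ZMod q) → ℂ, f ≠ 0 → Spec q n i j f →
      2 ^ i * ((q : ℝ) - 1) ^ i * (q : ℝ) ^ e ≤ suppCard q n f := by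
  have hqR : (3 : ℝ) ≤ q := by exact_mod_cast hq
  have hqC : (q : ℂ) ≠ 0 := by exact_mod_cast NeZero.ne q
  intro n
  induction n with
  | zero =>
    intro i j e h f hf _
    obtain ⟨rfl, rfl, rfl⟩ : i = 0 ∧ j = 0 ∧ e = 0 := by omega
    obtain ⟨x, hx⟩ := Function.ne_iff.1 hf
    have : 0 < suppCard q 0 f := Finset.card_pos.2 ⟨x, Finset.mem_filter.2 ⟨mem_univ _, hx⟩⟩
    simpa using (by exact_mod_cast this : (1 : ℝ) ≤ suppCard q 0 f)
  | succ n ih =>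
    intro i j e hn f hf hS
    by_cases hdep : ∃ r k m, slc f r k ≠ slc f r m
    swap
    · push Not at hdep
      have hc := const_of_slices f hdep
      obtain ⟨x, hx⟩ := Function.ne_iff.1 hf
      have hi : i = 0 := by
        have h0 : fhat q (n + 1) f 0 ≠ 0 := by
          have : ∀ y, f y * (starRingEnd ℂ) (chi q (n + 1) 0 y) = f x := by
            intro y
            rw [conj_chi, hc y x]; simp
          simp only [fhat, this]
          simpa [hqC] using hx
        have := (hS 0 h0).1
        simpa using this
      subst hi
      have h1 : suppCard q (n + 1) f = q ^ (n + 1) := by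
        rw [suppCard, Finset.filter_true_of_mem]
        · simp [ZMod.card]
        · intro y _
          rw [hc y x]; exact hx
      rw [h1]
      push_cast
      simp only [pow_zero, one_mul]
      exact pow_le_pow_right₀ (by linarith) (by omega)
    · obtain ⟨r, k, m, hkm⟩ := hdep
      -- the difference lemma
      have hdiff : ∀ k m v, fhat q n (slc f r k - slc f r m) v ≠ 0 →
          i ≤ hammingNorm v + 1 ∧ hammingNorm v + 1 ≤ j := by
        intro k m v hv
        obtain ⟨a, ha, hav⟩ := fhat_slice_sub_exists q n f r k m v hv
        have := hS _ hav
        rw [hammingNorm_insertNth, if_pos ha] at this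
        omega
      obtain ⟨v, hv⟩ := exists_fhat_ne_zero q n _ (sub_ne_zero.2 hkm)
      have hj := (hdiff k m v hv).2
      obtain ⟨j, rfl⟩ : ∃ j', j = j' + 1 := ⟨j - 1, by omega⟩
      rcases i with _ | i
      · have h1 := ih 0 j e (by omega) _ (sub_ne_zero.2 hkm) (by
          intro v hv
          have := hdiff k m v hv
          omega)
        have h2 := suppCard_sub q n (slc f r k) (slc f r m)
        have hne : k ≠ m := fun h => hkm (h ▸ rfl)
        have hle : ∑ l ∈ ({k, m} : Finset (ZMod q)), (suppCard q n (slc f r l) : ℝ)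
            ≤ ∑ l, (suppCard q n (slc f r l) : ℝ) :=
          Finset.sum_le_sum_of_subset_of_nonneg (subset_univ _) (fun i _ _ => by positivity)
        rw [Finset.sum_pair hne] at hle
        rw [suppCard_slices q n f r]
        linarith
      · set C : ℝ := 2 ^ i * ((q : ℝ) - 1) ^ i * (q : ℝ) ^ e with hCdef
        have hC : 0 ≤ C := by
          have : (0 : ℝ) ≤ q - 1 := by linarith
          positivity
        have hT : 2 ^ (i + 1) * ((q : ℝ) - 1) ^ (i + 1) * (q : ℝ) ^ e = 2 * ((q : ℝ) - 1) * C := by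
          rw [hCdef]; ring
        have hcross : ∀ k m, slc f r k ≠ slc f r m →
            q * C ≤ (suppCard q n (slc f r k) : ℝ) + suppCard q n (slc f r m) := by
          intro k m hkm
          have h1 := ih i j (e + 1) (by omega) _ (sub_ne_zero.2 hkm) (by
            intro v hv
            have := hdiff k m v hv
            omega)
          have h2 := suppCard_sub q n (slc f r k) (slc f r m)
          have h3 : 2 ^ i * ((q : ℝ) - 1) ^ i * (q : ℝ) ^ (e + 1) = q * C := by rw [hCdef]; ring
          linarith
        have hone : ∀ k, slc f r k ≠ 0 → C ≤ suppCard q n (slc f r k) := by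
          intro k hk
          refine ih i (j + 1) e (by omega) _ hk ?_
          intro v hv
          obtain ⟨a, ha⟩ := fhat_slice_exists q n f r k v hv
          have := hS _ ha
          rw [hammingNorm_insertNth] at this
          split_ifs at this <;> omega
        rw [suppCard_slices q n f r, hT]
        rcases comb_star (fun k => slc f r k) (fun k => (suppCard q n (slc f r k) : ℝ)) q hq
          (ZMod.card q) (fun k => by positivity) C hC hcross k m hkm with h | ⟨k0, hk0⟩
        · exact h
        · obtain ⟨l, hl⟩ : ∃ l, l ≠ k0 := by
            by_cases h : k = k0
            · exact ⟨m, fun h' => hkm (by rw [h, h'])⟩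
            · exact ⟨k, h⟩
          have hall : ∀ l', l' ≠ k0 → slc f r l' = slc f r l := fun l' h' => hk0 l' h' l hl
          have hne : slc f r k0 ≠ slc f r l := by
            intro h
            have : ∀ x, slc f r x = slc f r l := fun x => by
              by_cases hx : x = k0
              · rw [hx, h]
              · exact hall x hx
            exact hkm (by rw [this k, this m])
          have hsum : ∑ x, (suppCard q n (slc f r x) : ℝ)
              = suppCard q n (slc f r k0) + ((q : ℝ) - 1) * suppCard q n (slc f r l) := by
            rw [← Finset.add_sum_erase univ _ (mem_univ k0)]
            congr 1
            rw [Finset.sum_congr rfl (g := fun _ => (suppCard q n (slc f r l) : ℝ)) (by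
              intro x hx
              rw [hall x (Finset.ne_of_mem_erase hx)])]
            rw [Finset.sum_const, Finset.card_erase_of_mem (mem_univ _), Finset.card_univ,
              ZMod.card, nsmul_eq_mul, Nat.cast_sub (by omega), Nat.cast_one]
          rw [hsum]
          by_cases h0 : slc f r l = 0
          · have h1 : slc f r k0 ≠ 0 := by rw [← h0]; exact hne
            have h2 := ih (i + 1) j e (by omega) _ h1 (by
              intro v hv
              have h3 := hdiff k0 l v (by rwa [h0, sub_zero])
              have h4 : fhat q (n + 1) f (r.insertNth 0 v) ≠ 0 := by
                rw [fhat_slice_sum, Finset.sum_eq_single k0]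
                · exact mul_ne_zero (by simpa using hqC) hv
                · intro x _ hx
                  rw [hall x hx, h0]
                  simp [fhat]
                · simp
              have h5 := hS _ h4
              rw [hammingNorm_insertNth] at h5
              simp at h5
              omega)
            have h6 : (0 : ℝ) ≤ ((q : ℝ) - 1) * suppCard q n (slc f r l) :=
              mul_nonneg (by linarith) (by positivity)
            linarith
          · have h1 := hone l h0
            have h2 := hcross k0 l hne
            nlinarith

end support

section final

lemma insertNth_add_single {q n : ℕ} (r : Fin (n + 1)) (k c : ZMod q) (y : Fin n → ZMod q) :
    (r.insertNth k y : Fin (n + 1) → ZMod q) + Pi.single r c = r.insertNth (k + c) y := by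
  funext t
  refine Fin.succAboveCases r ?_ (fun t => ?_) t
  · simp
  · simp [Fin.succAbove_ne]

lemma energy_slices (q n : ℕ) [NeZero q] (f : (Fin (n + 1) → ZMod q) → ℂ)
    (hbool : ∀ x, f x = 1 ∨ f x = -1) (r : Fin (n + 1)) :
    ∑ c : ZMod q, ∑ x, ‖f x - f (x + Pi.single r c)‖ ^ 2
      = ∑ k, ∑ b, 4 * (suppCard q n (slc f r k - slc f r b) : ℝ) := by
  rw [Finset.sum_comm, sum_insertNth r]
  refine Finset.sum_congr rfl fun k _ => ?_
  rw [Finset.sum_comm]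
  simp only [insertNth_add_single]
  rw [← Equiv.sum_comp (Equiv.addLeft k)
    (fun b => 4 * (suppCard q n (slc f r k - slc f r b) : ℝ))]
  refine Finset.sum_congr rfl fun c _ => ?_
  rw [suppCard, Finset.card_filter, Nat.cast_sum, Finset.mul_sum]
  refine Finset.sum_congr rfl fun y _ => ?_
  have e1 : (slc f r k - slc f r (Equiv.addLeft k c)) y
      = f (r.insertNth k y) - f (r.insertNth (k + c) y) := rfl
  rcases hbool (r.insertNth k y) with h | h <;> rcases hbool (r.insertNth (k + c) y) with h' | h' <;>
    rw [h, h'] at e1 ⊢ <;> simp only [e1] <;> norm_num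

lemma cross_sum {ι : Type*} [Fintype ι] {X : Type*} (F : ι → X) (W : ι → ι → ℝ) (S : ℝ)
    (hW : ∀ a b, 0 ≤ W a b) (hc : ∀ a b, F a ≠ F b → S ≤ W a b) (a0 b0 : ι)
    (h0 : F a0 ≠ F b0) : 2 * ((Fintype.card ι : ℝ) - 1) * S ≤ ∑ a, ∑ b, W a b := by
  have hne : a0 ≠ b0 := fun h => h0 (h ▸ rfl)
  have h1 : ∀ c, S ≤ W a0 c + W b0 c := by
    intro c
    by_cases h : F a0 = F c
    · have := hc b0 c (fun h' => h0 (by rw [h, h']))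
      linarith [hW a0 c]
    · linarith [hc a0 c h, hW b0 c]
  have h2 : ∀ c, S ≤ ∑ b, W c b := by
    intro c
    have hle : ∑ l ∈ ({a0, b0} : Finset ι), W c l ≤ ∑ l, W c l :=
      Finset.sum_le_sum_of_subset_of_nonneg (subset_univ _) (fun i _ _ => hW c i)
    rw [Finset.sum_pair hne] at hle
    by_cases h : F c = F a0
    · have := hc c b0 (fun h' => h0 (by rw [← h, h']))
      linarith [hW c a0]
    · linarith [hc c a0 h, hW c b0]
  rw [← Finset.add_sum_erase univ _ (mem_univ a0),
    ← Finset.add_sum_erase (univ.erase a0) _ (Finset.mem_erase.2 ⟨hne.symm, mem_univ b0⟩)]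
  have h3 : (Fintype.card ι : ℝ) * S ≤ ∑ b, W a0 b + ∑ b, W b0 b := by
    rw [← Finset.sum_add_distrib, ← nsmul_eq_mul, ← Finset.card_univ]
    exact Finset.card_nsmul_le_sum _ _ _ (fun c _ => h1 c)
  have h4 : ((Fintype.card ι : ℝ) - 2) * S ≤ ∑ a ∈ (univ.erase a0).erase b0, ∑ b, W a b := by
    have h5 := Finset.card_nsmul_le_sum ((univ.erase a0).erase b0) (fun a => ∑ b, W a b) S
      (fun c _ => h2 c)
    have h6 : (((univ.erase a0).erase b0).card : ℝ) = (Fintype.card ι : ℝ) - 2 := by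
      have e1 := Finset.card_erase_add_one (mem_univ a0)
      have e2 := Finset.card_erase_add_one
        (Finset.mem_erase.2 ⟨hne.symm, mem_univ b0⟩ : b0 ∈ univ.erase a0)
      rw [Finset.card_univ] at e1
      have : (((univ.erase a0).erase b0).card : ℝ) + 2 = Fintype.card ι := by
        rw [← e1, ← e2]; push_cast; ring
      linarith
    rwa [nsmul_eq_mul, h6] at h5
  linarith

lemma total_energy (q n d : ℕ) [NeZero q] (f : (Fin n → ZMod q) → ℂ)
    (hbool : ∀ x, f x = 1 ∨ f x = -1)
    (hcoef : ∀ u : Fin n → ZMod q, fhat q n f u ≠ 0 → hammingNorm u ≤ d) :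
    ∑ i, ∑ c : ZMod q, ∑ x, ‖f x - f (x + Pi.single i c)‖ ^ 2 ≤ 2 * d * (q : ℝ) ^ (n + 1) := by
  have hq : (q : ℝ) ≠ 0 := by exact_mod_cast NeZero.ne q
  simp only [energy]
  rw [← Finset.mul_sum, Finset.sum_comm]
  have h1 : ∑ u, ‖fhat q n f u‖ ^ 2 = 1 := by
    rw [parseval]
    have : ∀ x, ‖f x‖ ^ 2 = 1 := fun x => by
      rcases hbool x with h | h <;> rw [h] <;> simp
    simp [this, ZMod.card, hq]
  have h2 : ∑ u : Fin n → ZMod q, ∑ i, (if u i ≠ 0 then 2 * (q : ℝ) else 0) * ‖fhat q n f u‖ ^ 2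
      ≤ ∑ u : Fin n → ZMod q, 2 * q * d * ‖fhat q n f u‖ ^ 2 := by
    refine Finset.sum_le_sum fun u _ => ?_
    rw [← Finset.sum_mul]
    by_cases h : fhat q n f u = 0
    · simp [h]
    · refine mul_le_mul_of_nonneg_right ?_ (by positivity)
      have h3 : ∑ i, (if u i ≠ 0 then 2 * (q : ℝ) else 0) = 2 * q * hammingNorm u := by
        rw [← Finset.sum_filter, Finset.sum_const, nsmul_eq_mul, mul_comm]
        rfl
      rw [h3]
      have h4 : (hammingNorm u : ℝ) ≤ d := by exact_mod_cast hcoef u h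
      gcongr
  rw [← Finset.mul_sum, h1] at h2
  calc _ ≤ (q : ℝ) ^ n * (2 * q * d * 1) := by gcongr
    _ = _ := by ring

end final

theorem stmt10 (q n d d' : ℕ) [NeZero q] (hq : 3 ≤ q) (hd' : 1 ≤ d') (hdd : d' ≤ d)
    (hdn : d ≤ n) (hsum : d' + d ≤ n + 1)
    (f : (Fin n → ZMod q) → ℂ) (hbool : ∀ x, f x = 1 ∨ f x = -1)
    (hcoef : ∀ u : Fin n → ZMod q, fhat q n f u ≠ 0 →
      hammingNorm u = 0 ∨ (d' ≤ hammingNorm u ∧ hammingNorm u ≤ d)) :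
    ((univ.filter (fun i : Fin n => Relevant f i)).card : ℝ)
      ≤ (d : ℝ) / 2 * (q : ℝ) ^ (d + d') / (2 ^ d' * ((q : ℝ) - 1) ^ d') := by
  have hqR : (3 : ℝ) ≤ q := by exact_mod_cast hq
  obtain ⟨i, rfl⟩ : ∃ i, d' = i + 1 := ⟨d' - 1, by omega⟩
  obtain ⟨j, rfl⟩ : ∃ j, d = j + 1 := ⟨d - 1, by omega⟩
  obtain ⟨n, rfl⟩ : ∃ m, n = m + 1 := ⟨n - 1, by omega⟩
  obtain ⟨e, hn⟩ : ∃ e, n = i + j + e := ⟨n - (i + j), by omega⟩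
  have hupper := total_energy q (n + 1) (j + 1) f hbool (fun u hu => by
    have := hcoef u hu
    omega)
  set S : ℝ := 2 ^ i * ((q : ℝ) - 1) ^ i * (q : ℝ) ^ e with hS
  have hq1 : (0 : ℝ) < q - 1 := by linarith
  have hq0 : (0 : ℝ) < q := by linarith
  have hlow : ∀ r ∈ univ.filter (fun r : Fin (n + 1) => Relevant f r),
      8 * ((q : ℝ) - 1) * S ≤ ∑ c : ZMod q, ∑ x, ‖f x - f (x + Pi.single r c)‖ ^ 2 := by
    intro r hr
    obtain ⟨x, y, hxy, hne⟩ := (Finset.mem_filter.1 hr).2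
    rw [energy_slices q n f hbool r]
    have hrem : r.removeNth x = r.removeNth y := by
      funext t
      exact hxy _ (Fin.succAbove_ne r t)
    have h0 : slc f r (x r) ≠ slc f r (y r) := by
      intro h
      apply hne
      have := congrFun h (r.removeNth x)
      simp only [slc] at this
      rw [Fin.insertNth_self_removeNth, hrem, Fin.insertNth_self_removeNth] at this
      exact this
    have := cross_sum (fun k => slc f r k)
      (fun k b => 4 * (suppCard q n (slc f r k - slc f r b) : ℝ)) (4 * S)
      (fun a b => by positivity) (by
        intro a b hab
        have := supp_bound q hq n i j e hn _ (sub_ne_zero.2 hab) (by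
          intro v hv
          obtain ⟨c, hc, hcv⟩ := fhat_slice_sub_exists q n f r a b v hv
          have := hcoef _ hcv
          rw [hammingNorm_insertNth, if_pos hc] at this
          omega)
        show 4 * S ≤ _
        linarith) (x r) (y r) h0
    rw [ZMod.card] at this
    linarith
  have hcardle := Finset.card_nsmul_le_sum _ _ _ hlow
  have hsub : ∑ r ∈ univ.filter (fun r : Fin (n + 1) => Relevant f r),
      ∑ c : ZMod q, ∑ x, ‖f x - f (x + Pi.single r c)‖ ^ 2
      ≤ ∑ r, ∑ c : ZMod q, ∑ x, ‖f x - f (x + Pi.single r c)‖ ^ 2 :=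
    Finset.sum_le_sum_of_subset_of_nonneg (subset_univ _) (fun i _ _ => by positivity)
  rw [nsmul_eq_mul] at hcardle
  set N : ℝ := ((univ.filter (fun r : Fin (n + 1) => Relevant f r)).card : ℝ) with hN
  have hfin : N * (8 * ((q : ℝ) - 1) * S) ≤ 2 * ((j + 1 : ℕ) : ℝ) * (q : ℝ) ^ (n + 1 + 1) :=
    hcardle.trans (hsub.trans hupper)
  rw [le_div_iff₀ (by positivity)]
  have hpe : (0 : ℝ) < (q : ℝ) ^ e := by positivity
  refine le_of_mul_le_mul_right ?_ hpe
  have e1 : N * (2 ^ (i + 1) * ((q : ℝ) - 1) ^ (i + 1)) * (q : ℝ) ^ e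
      = N * (8 * ((q : ℝ) - 1) * S) / 4 := by
    rw [hS]; ring
  have e2 : ((j + 1 : ℕ) : ℝ) / 2 * (q : ℝ) ^ (j + 1 + (i + 1)) * (q : ℝ) ^ e
      = 2 * ((j + 1 : ℕ) : ℝ) * (q : ℝ) ^ (n + 1 + 1) / 4 := by
    rw [hn]; ring
  rw [e1, e2]
  linarith
end

section
/- Let q ≥ 3 and 1 ≤ d ≤ (n+1)/2. Any equitable 2-partition of the Hamming graph H(n,q) whose quotient matrix has second eigenvalue n(q−1) − qd has at most (d/2) · q^{2d} / (2^d (q−1)^d) relevant variables. -/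
open Finset BigOperators
open scoped Classical

namespace HamAux

open Polynomial

variable {q : ℕ} [NeZero q]

/-- The Laplacian of the Hamming graph. -/
noncomputable def lap (q n : ℕ) [NeZero q] : Module.End ℝ ((Fin n → ZMod q) → ℝ) where
  toFun f := fun x => ∑ r : Fin n, ∑ a : ZMod q, (f x - f (Function.update x r a))
  map_add' f g := by
    funext x
    simp only [Pi.add_apply, ← Finset.sum_add_distrib]
    refine Finset.sum_congr rfl fun r _ => Finset.sum_congr rfl fun a _ => by ring
  map_smul' c f := by
    funext x
    simp only [Pi.smul_apply, smul_eq_mul, RingHom.id_apply, Finset.mul_sum]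
    refine Finset.sum_congr rfl fun r _ => Finset.sum_congr rfl fun a _ => by ring

lemma lap_apply (n : ℕ) (f : (Fin n → ZMod q) → ℝ) (x : Fin n → ZMod q) :
    lap q n f x = ∑ r : Fin n, ∑ a : ZMod q, (f x - f (Function.update x r a)) := rfl

/-- slice -/
noncomputable def slice (q n : ℕ) (r : Fin (n + 1)) (k : ZMod q) :
    ((Fin (n + 1) → ZMod q) → ℝ) →ₗ[ℝ] ((Fin n → ZMod q) → ℝ) where
  toFun f := fun y => f (r.insertNth k y)
  map_add' f g := rfl
  map_smul' c f := rfl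

lemma slice_apply (n : ℕ) (r : Fin (n + 1)) (k : ZMod q) (f : (Fin (n + 1) → ZMod q) → ℝ)
    (y : Fin n → ZMod q) : slice q n r k f y = f (r.insertNth k y) := rfl

lemma update_insertNth_same {n : ℕ} (r : Fin (n + 1)) (k a : ZMod q) (y : Fin n → ZMod q) :
    Function.update (r.insertNth k y : Fin (n + 1) → ZMod q) r a = r.insertNth a y := by
  funext j
  refine Fin.succAboveCases r ?_ (fun s => ?_) j
  · simp
  · simp

lemma update_insertNth_succAbove {n : ℕ} (r : Fin (n + 1)) (s : Fin n) (k a : ZMod q)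
    (y : Fin n → ZMod q) :
    Function.update (r.insertNth k y : Fin (n + 1) → ZMod q) (r.succAbove s) a
      = r.insertNth k (Function.update y s a) := by
  funext j
  refine Fin.succAboveCases r ?_ (fun t => ?_) j
  · simp
  · by_cases h : t = s
    · subst h; simp
    · simp [h]

lemma slice_lap (n : ℕ) (r : Fin (n + 1)) (k : ZMod q) (f : (Fin (n + 1) → ZMod q) → ℝ) :
    slice q n r k (lap q (n + 1) f) =
      lap q n (slice q n r k f) + (q : ℝ) • slice q n r k f - ∑ m, slice q n r m f := by
  funext y
  simp only [slice_apply, Pi.sub_apply, Pi.add_apply, Pi.smul_apply, smul_eq_mul,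
    Finset.sum_apply, lap_apply]
  rw [Fin.sum_univ_succAbove _ r]
  simp only [update_insertNth_same, update_insertNth_succAbove, Finset.sum_sub_distrib]
  simp [ZMod.card]
  ring

lemma aeval_intertwine {M N : Type*} [AddCommGroup M] [Module ℝ M] [AddCommGroup N] [Module ℝ N]
    (A : Module.End ℝ M) (B : Module.End ℝ N) (T : M →ₗ[ℝ] N)
    (h : ∀ f, T (A f) = B (T f)) (p : ℝ[X]) (f : M) :
    T (aeval A p f) = aeval B p (T f) := by
  have hpow : ∀ (m : ℕ) (f : M), T ((A ^ m) f) = (B ^ m) (T f) := by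
    intro m
    induction m with
    | zero => intro f; simp
    | succ m ih => intro f; rw [pow_succ, pow_succ]; simp [ih, h]
  induction p using Polynomial.induction_on' with
  | add p r hp hr => simp [hp, hr]
  | monomial m c => simp [aeval_monomial, hpow, Module.algebraMap_end_apply]

/-- The annihilating polynomial. -/
noncomputable def P (q : ℕ) (A : Finset ℤ) : ℝ[X] := ∏ t ∈ A, (X - C ((q : ℝ) * t))

/-- Sum of eigenspaces. -/
def U (q n : ℕ) [NeZero q] (A : Finset ℤ) (f : (Fin n → ZMod q) → ℝ) : Prop :=
  aeval (lap q n) (P q A) f = 0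

lemma U_mono {n : ℕ} {A B : Finset ℤ} (h : A ⊆ B) {f : (Fin n → ZMod q) → ℝ}
    (hf : U q n A f) : U q n B f := by
  unfold U at *
  have : P q B = P q (B \ A) * P q A := by
    unfold P; exact (Finset.prod_sdiff h).symm
  rw [this, map_mul, Module.End.mul_apply, hf, map_zero]

lemma U_empty {n : ℕ} {f : (Fin n → ZMod q) → ℝ} (hf : U q n ∅ f) : f = 0 := by
  simpa [U, P] using hf

lemma U_add {n : ℕ} {A : Finset ℤ} {f g : (Fin n → ZMod q) → ℝ}
    (hf : U q n A f) (hg : U q n A g) : U q n A (f + g) := by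
  unfold U at *; rw [map_add, hf, hg, add_zero]

lemma U_smul {n : ℕ} {A : Finset ℤ} {f : (Fin n → ZMod q) → ℝ} (c : ℝ)
    (hf : U q n A f) : U q n A (c • f) := by
  unfold U at *; rw [map_smul, hf, smul_zero]

lemma U_zero {n : ℕ} {A : Finset ℤ} : U q n A (0 : (Fin n → ZMod q) → ℝ) := by
  unfold U; rw [map_zero]

lemma U_sum {n : ℕ} {A : Finset ℤ} {ι : Type*} (s : Finset ι) (f : ι → (Fin n → ZMod q) → ℝ)
    (hf : ∀ i ∈ s, U q n A (f i)) : U q n A (∑ i ∈ s, f i) := by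
  unfold U at *; rw [map_sum]; exact Finset.sum_eq_zero hf

lemma q_pos : (0 : ℝ) < q := by exact_mod_cast Nat.pos_of_ne_zero (NeZero.ne q)

lemma U_inter {n : ℕ} {A B : Finset ℤ} {f : (Fin n → ZMod q) → ℝ}
    (hf : U q n A f) (hg : U q n B f) : U q n (A ∩ B) f := by
  unfold U at *
  have hA : P q A = P q (A \ B) * P q (A ∩ B) := by
    unfold P
    rw [← Finset.sdiff_inter_self_left]
    exact (Finset.prod_sdiff Finset.inter_subset_left).symm
  have hB : P q B = P q (B \ A) * P q (A ∩ B) := by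
    unfold P
    rw [← Finset.sdiff_inter_self_left, Finset.inter_comm A B]
    exact (Finset.prod_sdiff Finset.inter_subset_left).symm
  have hcop : IsCoprime (P q (A \ B)) (P q (B \ A)) := by
    unfold P
    refine IsCoprime.prod_left fun s hs => IsCoprime.prod_right fun t ht => ?_
    apply Polynomial.isCoprime_X_sub_C_of_isUnit_sub
    rw [isUnit_iff_ne_zero, ← mul_sub]
    refine mul_ne_zero q_pos.ne' ?_
    rw [sub_ne_zero]
    intro h
    have h : s = t := by exact_mod_cast h
    subst h
    simp at hs ht
    exact ht.2 hs.1
  obtain ⟨u, v, huv⟩ := hcop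
  rw [hA, map_mul, Module.End.mul_apply] at hf
  rw [hB, map_mul, Module.End.mul_apply] at hg
  have := congrArg (fun p => aeval (lap q n) p (aeval (lap q n) (P q (A ∩ B)) f)) huv
  simp only [map_add, map_mul, LinearMap.add_apply, Module.End.mul_apply, hf, hg, map_zero,
    map_one, Module.End.one_apply, add_zero] at this
  exact this.symm

lemma P_shift (i j : ℤ) : (P q (Finset.Icc i j)).comp (X + C (q : ℝ))
    = P q (Finset.Icc (i - 1) (j - 1)) := by
  unfold P
  rw [Polynomial.prod_comp]
  refine Finset.prod_bij (fun t _ => t - 1) ?_ ?_ ?_ ?_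
  · intro t ht; simp at ht ⊢; omega
  · intro s _ t _ h; simpa using h
  · intro t ht; simp at ht; exact ⟨t + 1, by simp; omega, by simp⟩
  · intro t _
    simp only [sub_comp, X_comp, C_comp, Int.cast_sub, Int.cast_one, mul_sub, mul_one, C_sub]
    ring

lemma U_diff {n : ℕ} {i j : ℤ} {f : (Fin (n + 1) → ZMod q) → ℝ}
    (hf : U q (n + 1) (Finset.Icc i j) f) (r : Fin (n + 1)) (k m : ZMod q) :
    U q n (Finset.Icc (i - 1) (j - 1)) (slice q n r k f - slice q n r m f) := by
  unfold U at *
  have h := aeval_intertwine (lap q (n + 1)) (aeval (lap q n) (X + C (q : ℝ)))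
    (slice q n r k - slice q n r m) (by
      intro f
      simp only [LinearMap.sub_apply, slice_lap, map_add, aeval_X, aeval_C, LinearMap.add_apply,
        Module.algebraMap_end_apply, map_sub, smul_sub]
      abel) (P q (Finset.Icc i j)) f
  rw [hf, map_zero, ← aeval_comp, P_shift] at h
  exact h.symm

lemma U_sumslice {n : ℕ} {A : Finset ℤ} {f : (Fin (n + 1) → ZMod q) → ℝ}
    (hf : U q (n + 1) A f) (r : Fin (n + 1)) :
    U q n A (∑ k, slice q n r k f) := by
  unfold U at *
  have h := aeval_intertwine (lap q (n + 1)) (lap q n)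
    (∑ k, slice q n r k) (by
      intro f
      simp only [LinearMap.sum_apply, slice_lap, map_sum, Finset.sum_add_distrib,
        Finset.sum_sub_distrib, Finset.sum_const, Finset.card_univ, ZMod.card, ← Finset.smul_sum,
        Nat.cast_smul_eq_nsmul]
      abel) (P q A) f
  rw [hf, map_zero, LinearMap.sum_apply] at h
  exact h.symm

lemma U_slice {n : ℕ} {i j : ℤ} {f : (Fin (n + 1) → ZMod q) → ℝ}
    (hf : U q (n + 1) (Finset.Icc i j) f) (r : Fin (n + 1)) (k : ZMod q) :
    U q n (Finset.Icc (i - 1) j) (slice q n r k f) := by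
  have h1 : U q n (Finset.Icc (i - 1) j) (∑ m, slice q n r m f) :=
    U_mono (Finset.Icc_subset_Icc (by omega) le_rfl) (U_sumslice hf r)
  have h2 : U q n (Finset.Icc (i - 1) j) (∑ m, (slice q n r k f - slice q n r m f)) :=
    U_sum _ _ fun m _ => U_mono (Finset.Icc_subset_Icc le_rfl (by omega)) (U_diff hf r k m)
  have h3 := U_smul ((q : ℝ)⁻¹) (U_add h1 h2)
  convert h3 using 1
  rw [Finset.sum_sub_distrib, add_sub_cancel, Finset.sum_const, Finset.card_univ, ZMod.card,
    ← Nat.cast_smul_eq_nsmul ℝ, smul_smul, inv_mul_cancel₀ q_pos.ne', one_smul]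

lemma lap_add_inj {n : ℕ} {f : (Fin n → ZMod q) → ℝ} (h : lap q n f + (q : ℝ) • f = 0) :
    f = 0 := by
  have key : ∀ g : (Fin n → ZMod q) → ℝ, lap q n g + (q : ℝ) • g = 0 → ∀ x, g x ≤ 0 := by
    intro g hg x
    obtain ⟨x0, hx0⟩ := Finite.exists_max g
    refine (hx0 x).trans ?_
    have h0 := congrFun hg x0
    simp only [Pi.add_apply, Pi.smul_apply, smul_eq_mul, Pi.zero_apply, lap_apply] at h0
    have h1 : 0 ≤ ∑ r : Fin n, ∑ a : ZMod q, (g x0 - g (Function.update x0 r a)) :=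
      Finset.sum_nonneg fun r _ => Finset.sum_nonneg fun a _ => sub_nonneg.2 (hx0 _)
    have := q_pos (q := q)
    by_contra hc
    push Not at hc
    nlinarith [mul_pos this hc]
  funext x
  refine le_antisymm (key f h x) ?_
  have := key (-f) (by rw [map_neg, smul_neg, ← neg_add, h, neg_zero]) x
  simpa using this

lemma U_neg {n : ℕ} {j : ℤ} (hj : -1 ≤ j) {f : (Fin n → ZMod q) → ℝ}
    (hf : U q n (Finset.Icc (-1) j) f) : U q n (Finset.Icc 0 j) f := by
  unfold U at *
  have : P q (Finset.Icc (-1) j) = (X + C (q : ℝ)) * P q (Finset.Icc 0 j) := by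
    unfold P
    rw [← Finset.insert_Icc_add_one_left_eq_Icc hj, Finset.prod_insert (by simp)]
    simp
  rw [this, map_mul, Module.End.mul_apply] at hf
  apply lap_add_inj
  simpa only [map_add, aeval_X, aeval_C, LinearMap.add_apply, Module.algebraMap_end_apply] using hf

lemma U_const {n : ℕ} {A : Finset ℤ} (hA : (0 : ℤ) ∉ A) {f : (Fin n → ZMod q) → ℝ}
    (hf : U q n A f) (hl : lap q n f = 0) : f = 0 := by
  have h0 : U q n {0} f := by
    unfold U P
    simpa using hl
  have := U_inter hf h0
  rw [Finset.inter_singleton_of_notMem hA] at this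
  exact U_empty this

lemma exists_slices_ne {n : ℕ} {A : Finset ℤ} (hA : (0 : ℤ) ∉ A)
    {f : (Fin (n + 1) → ZMod q) → ℝ}
    (hf : U q (n + 1) A f) (hne : f ≠ 0) :
    ∃ r k m, slice q n r k f ≠ slice q n r m f := by
  by_contra hcon
  push Not at hcon
  apply hne
  apply U_const hA hf
  funext x
  rw [lap_apply]
  refine Finset.sum_eq_zero fun r _ => Finset.sum_eq_zero fun a _ => ?_
  have := congrFun (hcon r (x r) a) (r.removeNth x)
  rw [slice_apply, slice_apply, Fin.insertNth_self_removeNth] at this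
  rw [this, ← update_insertNth_same r (x r) a, Fin.insertNth_self_removeNth, sub_self]

/-- real-valued support size -/
noncomputable def S {n : ℕ} (f : (Fin n → ZMod q) → ℝ) : ℝ := ∑ y, if f y ≠ 0 then 1 else 0

lemma S_nonneg {n : ℕ} (f : (Fin n → ZMod q) → ℝ) : 0 ≤ S f :=
  Finset.sum_nonneg fun y _ => by split_ifs <;> norm_num

lemma S_sub_le {n : ℕ} (f g : (Fin n → ZMod q) → ℝ) : S (f - g) ≤ S f + S g := by
  unfold S
  rw [← Finset.sum_add_distrib]
  refine Finset.sum_le_sum fun y _ => ?_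
  by_cases h1 : f y = 0 <;> by_cases h2 : g y = 0 <;> simp [h1, h2] <;> split_ifs <;> norm_num

lemma S_ge_one {n : ℕ} {f : (Fin n → ZMod q) → ℝ} (hf : f ≠ 0) : 1 ≤ S f := by
  obtain ⟨y, hy⟩ := Function.ne_iff.1 hf
  unfold S
  have := Finset.single_le_sum (f := fun y => if f y ≠ 0 then (1 : ℝ) else 0)
    (fun y _ => by split_ifs <;> norm_num) (Finset.mem_univ y)
  simpa [show f y ≠ 0 from hy] using this

lemma sum_slice {n : ℕ} (r : Fin (n + 1)) (G : (Fin (n + 1) → ZMod q) → ℝ) :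
    ∑ x, G x = ∑ k, ∑ y, G (r.insertNth k y) := by
  rw [← Fintype.sum_prod_type' (f := fun (k : ZMod q) (y : Fin n → ZMod q) => G (r.insertNth k y))]
  exact (Equiv.sum_comp (Fin.insertNthEquiv (fun _ => ZMod q) r) G).symm

lemma S_slices {n : ℕ} (r : Fin (n + 1)) (f : (Fin (n + 1) → ZMod q) → ℝ) :
    S f = ∑ k, S (slice q n r k f) := by
  unfold S
  rw [sum_slice r]
  rfl

lemma comb {α β : Type*} [Fintype α] (F : α → β) (s : β → ℝ) (hs : ∀ b, 0 ≤ s b) (z : β) (B T : ℝ)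
    (hB : 0 ≤ B) (Q : ℝ) (hQ : Q = Fintype.card α) (hQ2 : 2 ≤ Q)
    (hT : T * Q = 2 * (Q - 1) * B)
    (h1 : ∀ k m, F k ≠ F m → B ≤ s (F k) + s (F m))
    (h2 : ∃ k m, F k ≠ F m)
    (h3 : ∀ k, F k ≠ z → B ≤ s (F k) * Q)
    (h4 : ∀ k0, (∀ k, k ≠ k0 → F k = z) → T ≤ s (F k0)) :
    T ≤ ∑ k, s (F k) := by
  obtain ⟨k0, m0, hkm⟩ := h2
  haveI : Nonempty α := ⟨k0⟩
  obtain ⟨k1, hk1⟩ := Finite.exists_min (fun k => s (F k))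
  set m := s (F k1) with hm
  have hm0 : 0 ≤ m := hs _
  have hhalf : T ≤ Q * B / 2 := by
    have : T * Q ≤ (Q * B / 2) * Q := by
      rw [hT]; nlinarith [mul_nonneg hB (sq_nonneg (Q - 2))]
    exact le_of_mul_le_mul_right this (by linarith)
  have hT2 : T ≤ 2 * B := by
    have : T * Q ≤ (2 * B) * Q := by rw [hT]; nlinarith
    exact le_of_mul_le_mul_right this (by linarith)
  by_cases hmB : B / 2 ≤ m
  · have : ∑ _k : α, B / 2 ≤ ∑ k, s (F k) := Finset.sum_le_sum fun k _ => hmB.trans (hk1 k)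
    rw [Finset.sum_const, Finset.card_univ, nsmul_eq_mul, ← hQ] at this
    linarith
  push Not at hmB
  set E := univ.filter (fun k => F k = F k1) with hE
  set D := univ.filter (fun k => ¬ F k = F k1) with hD
  have hcard : (E.card : ℝ) + D.card = Q := by
    rw [hQ]
    exact_mod_cast Finset.card_filter_add_card_filter_not (s := (univ : Finset α)) _
  have hsplit : ∑ k, s (F k) = ∑ k ∈ E, s (F k) + ∑ k ∈ D, s (F k) :=
    (Finset.sum_filter_add_sum_filter_not _ _ _).symm
  have hEs : E.card * m ≤ ∑ k ∈ E, s (F k) := by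
    rw [← nsmul_eq_mul]
    exact Finset.card_nsmul_le_sum _ _ _ fun k _ => hk1 k
  have hDs : D.card * (B - m) ≤ ∑ k ∈ D, s (F k) := by
    rw [← nsmul_eq_mul]
    refine Finset.card_nsmul_le_sum _ _ _ fun k hk => ?_
    have := h1 k k1 (by simpa [hD] using hk)
    linarith
  have hDne : 1 ≤ D.card := by
    rw [Nat.one_le_iff_ne_zero, Finset.card_ne_zero]
    by_cases h : F k0 = F k1
    · exact ⟨m0, by simp [hD]; intro h'; exact hkm (h.trans h'.symm)⟩
    · exact ⟨k0, by simp [hD, h]⟩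
  rw [hsplit]
  rcases Nat.lt_or_ge 1 D.card with hu | hu
  · have hu' : (2 : ℝ) ≤ D.card := by exact_mod_cast hu
    rcases le_total (D.card : ℝ) E.card with hle | hle
    · nlinarith [mul_nonneg (sub_nonneg.2 hle) hm0]
    · nlinarith [mul_nonneg (sub_nonneg.2 hle) (sub_nonneg.2 hmB.le)]
  · have hu1 : D.card = 1 := by omega
    by_cases hz : F k1 = z
    · obtain ⟨w, hw⟩ := Finset.card_eq_one.1 hu1
      have := h4 w (by
        intro k hk
        by_contra hne
        have : k ∈ D := by simp [hD, hz, hne]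
        rw [hw] at this
        exact hk (by simpa using this))
      rw [hw, Finset.sum_singleton]
      have : 0 ≤ ∑ k ∈ E, s (F k) := Finset.sum_nonneg fun _ _ => hs _
      linarith
    · have h5 := h3 k1 hz
      rw [← hm] at h5
      rw [hu1] at hcard hDs
      have hEc : (E.card : ℝ) = Q - 1 := by push_cast at hcard; linarith
      rw [hEc] at hEs
      push_cast at hDs
      have : T * Q ≤ (B + (Q - 2) * m) * Q := by
        rw [hT]; nlinarith
      have := le_of_mul_le_mul_right this (by linarith)
      linarith

theorem min_supp_zero (n : ℕ) : ∀ (j : ℕ), j ≤ n → ∀ f : (Fin n → ZMod q) → ℝ,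
    U q n (Finset.Icc 0 (j : ℤ)) f → f ≠ 0 → (q : ℝ) ^ n ≤ S f * q ^ j := by
  have hq := q_pos (q := q)
  induction n with
  | zero =>
    intro j hj f _ hne
    obtain rfl : j = 0 := by omega
    simpa using S_ge_one hne
  | succ n ih =>
    intro j hj f hf hne
    rcases Nat.lt_or_ge n j with hjn | hjn
    · obtain rfl : j = n + 1 := by omega
      exact le_mul_of_one_le_left (by positivity) (S_ge_one hne)
    by_cases hz : ∀ k, slice q n 0 k f ≠ 0
    · have : ∑ _k : ZMod q, (q : ℝ) ^ n ≤ ∑ k, S (slice q n 0 k f) * q ^ j :=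
        Finset.sum_le_sum fun k _ => ih j hjn _ (U_neg (by omega) (U_slice hf 0 k)) (hz k)
      rw [← Finset.sum_mul, ← S_slices, Finset.sum_const, Finset.card_univ, ZMod.card,
        nsmul_eq_mul] at this
      rw [pow_succ]; linarith
    · push Not at hz
      obtain ⟨k0, hk0⟩ := hz
      have : ∃ m, slice q n 0 m f ≠ 0 := by
        by_contra hcon
        push Not at hcon
        apply hne
        funext x
        have := congrFun (hcon (x 0)) (Fin.removeNth 0 x)
        rwa [slice_apply, Fin.insertNth_self_removeNth] at this
      obtain ⟨m, hm⟩ := this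
      have hU := U_diff hf 0 m k0
      rw [hk0, sub_zero] at hU
      have hU := U_neg (by omega) hU
      have hle : S (slice q n 0 m f) ≤ S f := by
        rw [S_slices 0 f]
        exact Finset.single_le_sum (f := fun k => S (slice q n 0 k f))
          (fun k _ => S_nonneg _) (Finset.mem_univ m)
      cases j with
      | zero => exact absurd (U_empty (by simpa using hU)) hm
      | succ j =>
        have := ih j (by omega) _ (by simpa using hU) hm
        rw [pow_succ, pow_succ, ← mul_assoc]
        refine mul_le_mul_of_nonneg_right (this.trans ?_) hq.le
        gcongr

theorem min_supp (hq2 : 2 ≤ q) (n : ℕ) : ∀ (i j : ℕ), i + j ≤ n → ∀ f : (Fin n → ZMod q) → ℝ,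
    U q n (Finset.Icc (i : ℤ) (j : ℤ)) f → f ≠ 0 →
    2 ^ i * ((q : ℝ) - 1) ^ i * (q : ℝ) ^ n ≤ S f * q ^ (i + j) := by
  have hq := q_pos (q := q)
  have hq2' : (2 : ℝ) ≤ q := by exact_mod_cast hq2
  induction n with
  | zero =>
    intro i j hij f _ hne
    obtain rfl : i = 0 := by omega
    obtain rfl : j = 0 := by omega
    simpa using S_ge_one hne
  | succ n ih =>
    intro i j hij f hf hne
    cases i with
    | zero =>
      simpa using min_supp_zero (n + 1) j (by omega) f (by simpa using hf) hne
    | succ i =>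
    cases j with
    | zero =>
      refine absurd (U_empty ?_) hne
      rwa [Finset.Icc_eq_empty (by simp)] at hf
    | succ j =>
    obtain ⟨r, k0, m0, hkm⟩ := exists_slices_ne (by simp) hf hne
    have hq1 : (0 : ℝ) ≤ q - 1 := by linarith
    -- B * q^(i+j) = 2^i (q-1)^i q^n
    set B : ℝ := 2 ^ i * ((q : ℝ) - 1) ^ i * (q : ℝ) ^ n / q ^ (i + j) with hB
    have hqp : (0 : ℝ) < q ^ (i + j) := by positivity
    have hBm : B * q ^ (i + j) = 2 ^ i * ((q : ℝ) - 1) ^ i * (q : ℝ) ^ n :=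
      div_mul_cancel₀ _ hqp.ne'
    have main : 2 * ((q : ℝ) - 1) * B / q ≤ ∑ k, S (slice q n r k f) := by
      refine comb (fun k => slice q n r k f) S S_nonneg 0 B _ (by positivity) q
        (by rw [ZMod.card]) hq2' (div_mul_cancel₀ _ hq.ne') ?_ ⟨k0, m0, hkm⟩ ?_ ?_
      · intro k m hne
        have h1 := ih i j (by omega) _ (by simpa using U_diff hf r k m) (sub_ne_zero.2 hne)
        rw [← hBm] at h1
        exact (le_of_mul_le_mul_right h1 hqp).trans (S_sub_le _ _)
      · intro k hk
        have h1 := ih i (j + 1) (by omega) _ (by simpa using U_slice hf r k) hk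
        rw [← hBm, ← add_assoc, pow_succ', ← mul_assoc] at h1
        exact le_of_mul_le_mul_right h1 hqp
      · intro w hw
        have hsum : ∑ k, slice q n r k f = slice q n r w f :=
          Finset.sum_eq_single w (fun k _ hk => hw k hk) (by simp)
        have hw0 : slice q n r w f ≠ 0 := by
          intro h0
          apply hkm
          have : ∀ k, slice q n r k f = 0 := fun k => by
            by_cases h : k = w
            · rw [h, h0]
            · exact hw k h
          rw [this, this]
        have hU1 := U_sumslice hf r
        rw [hsum] at hU1
        have hU2 : U q n (Finset.Icc (i : ℤ) (j : ℤ)) (slice q n r w f) := by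
          by_cases hx : ∃ v, v ≠ w
          · obtain ⟨v, hv⟩ := hx
            have := U_diff hf r w v
            rw [hw v hv, sub_zero] at this
            simpa using this
          · push Not at hx
            exact absurd (by rw [hx k0, hx m0]) hkm
        have hU3 := U_mono (B := Finset.Icc ((i + 1 : ℕ) : ℤ) (j : ℤ))
          (by intro t ht; simp at ht ⊢; omega) (U_inter hU1 hU2)
        have h1 := ih (i + 1) j (by omega) _ hU3 hw0
        rw [div_le_iff₀ hq]
        refine le_of_mul_le_mul_right ?_ hqp
        calc 2 * ((q : ℝ) - 1) * B * q ^ (i + j) = 2 * ((q : ℝ) - 1) * (B * q ^ (i + j)) := by ring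
          _ = 2 ^ (i + 1) * ((q : ℝ) - 1) ^ (i + 1) * (q : ℝ) ^ n := by rw [hBm]; ring
          _ ≤ _ := h1
          _ = _ := by ring
    rw [← S_slices, div_le_iff₀ hq] at main
    calc 2 ^ (i + 1) * ((q : ℝ) - 1) ^ (i + 1) * (q : ℝ) ^ (n + 1)
        = 2 * ((q : ℝ) - 1) * (2 ^ i * ((q : ℝ) - 1) ^ i * (q : ℝ) ^ n) * q := by ring
      _ = 2 * ((q : ℝ) - 1) * B * (q ^ (i + j) * q) := by rw [← hBm]; ring
      _ ≤ S f * q * (q ^ (i + j) * q) := by gcongr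
      _ = _ := by ring

/-- Neighbour sum versus coordinate changes. -/
lemma sum_update {n : ℕ} (f : (Fin n → ZMod q) → ℝ) (x : Fin n → ZMod q) :
    ∑ r : Fin n, ∑ a : ZMod q, f (Function.update x r a)
      = n * f x + ∑ y ∈ univ.filter (fun y => hammingDist x y = 1), f y := by
  have h1 : ∀ r : Fin n, ∑ a : ZMod q, f (Function.update x r a)
      = f x + ∑ a ∈ univ.filter (fun a => a ≠ x r), f (Function.update x r a) := by
    intro r
    rw [← Finset.sum_filter_add_sum_filter_not univ (fun a => a = x r)]
    simp [Finset.filter_eq']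
  simp only [h1, Finset.sum_add_distrib]
  congr 1
  · simp
  rw [Finset.sum_sigma']
  refine Finset.sum_bij (fun p _ => Function.update x p.1 p.2) ?_ ?_ ?_ ?_
  · rintro ⟨r, a⟩ h
    simp at h
    simp only [Finset.mem_filter, Finset.mem_univ, true_and, hammingDist]
    rw [Finset.card_eq_one]
    refine ⟨r, ?_⟩
    ext j
    by_cases hj : j = r
    · subst hj; simp [Ne.symm h]
    · simp [hj]
  · rintro ⟨r, a⟩ h ⟨s, b⟩ h' heq
    simp at h h'
    have hrs : r = s := by
      by_contra hne
      have := congrFun heq r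
      simp [hne] at this
      exact h this
    subst hrs
    have := congrFun heq r
    simp at this
    rw [this]
  · intro y hy
    simp only [Finset.mem_filter, Finset.mem_univ, true_and, hammingDist] at hy
    obtain ⟨r, hr⟩ := Finset.card_eq_one.1 hy
    have hmem : ∀ j, x j ≠ y j ↔ j = r := by
      intro j
      have := Finset.ext_iff.1 hr j
      simpa using this
    refine ⟨⟨r, y r⟩, ?_, ?_⟩
    · simp
      exact Ne.symm ((hmem r).2 rfl)
    · funext j
      by_cases hj : j = r
      · subst hj; simp
      · simp [hj]
        by_contra hc
        exact hj ((hmem j).1 hc)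
  · intros; rfl

lemma lap_eq {n : ℕ} (f : (Fin n → ZMod q) → ℝ) (x : Fin n → ZMod q) :
    lap q n f x = n * (q - 1) * f x - ∑ y ∈ univ.filter (fun y => hammingDist x y = 1), f y := by
  rw [lap_apply]
  simp only [Finset.sum_sub_distrib]
  rw [sum_update]
  simp [ZMod.card]
  ring

/-- Sum of `h x (update x r a)` is symmetric. -/
lemma sum_swap {n : ℕ} (r : Fin (n + 1))
    (h : (Fin (n + 1) → ZMod q) → (Fin (n + 1) → ZMod q) → ℝ) :
    ∑ x, ∑ a : ZMod q, h x (Function.update x r a)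
      = ∑ k, ∑ m, ∑ y, h (r.insertNth k y) (r.insertNth m y) := by
  rw [sum_slice r]
  simp only [update_insertNth_same]
  refine Finset.sum_congr rfl fun k _ => Finset.sum_comm

lemma sum_lap {n : ℕ} (f : (Fin (n + 1) → ZMod q) → ℝ) : ∑ x, lap q (n + 1) f x = 0 := by
  simp only [lap_apply]
  rw [Finset.sum_comm]
  refine Finset.sum_eq_zero fun r _ => ?_
  rw [sum_swap r (fun x y => f x - f y)]
  simp only [Finset.sum_sub_distrib]
  rw [sub_eq_zero]
  exact Finset.sum_comm

lemma dirichlet {n : ℕ} (f : (Fin (n + 1) → ZMod q) → ℝ) :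
    ∑ r : Fin (n + 1), ∑ k, ∑ m, ∑ y, (f (r.insertNth k y) - f (r.insertNth m y)) ^ 2
      = 2 * ∑ x, f x * lap q (n + 1) f x := by
  have h1 : ∑ x, f x * lap q (n + 1) f x
      = ∑ r : Fin (n + 1), ∑ k, ∑ m, ∑ y,
        f (r.insertNth k y) * (f (r.insertNth k y) - f (r.insertNth m y)) := by
    simp only [lap_apply, Finset.mul_sum]
    rw [Finset.sum_comm]
    exact Finset.sum_congr rfl fun r _ => sum_swap r (fun x y => f x * (f x - f y))
  rw [h1, Finset.mul_sum]
  refine Finset.sum_congr rfl fun r _ => ?_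
  have h2 : ∑ k, ∑ m, ∑ y, f (r.insertNth k y) * (f (r.insertNth k y) - f (r.insertNth m y))
      = ∑ k, ∑ m, ∑ y, f (r.insertNth m y) * (f (r.insertNth m y) - f (r.insertNth k y)) :=
    Finset.sum_comm
  rw [two_mul]
  nth_rewrite 2 [h2]
  simp only [← Finset.sum_add_distrib]
  refine Finset.sum_congr rfl fun k _ => Finset.sum_congr rfl fun m _ =>
    Finset.sum_congr rfl fun y _ => by ring

lemma pair_count {α : Type*} [Fintype α] (N : α → α → ℝ) (B : ℝ) (hN : ∀ k m, 0 ≤ N k m)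
    (k0 m0 : α) (hne : k0 ≠ m0) (h : ∀ k, B ≤ N k k0 + N k m0)
    (h' : ∀ k, B ≤ N k0 k + N m0 k) :
    2 * ((Fintype.card α : ℝ) - 1) * B ≤ ∑ k, ∑ m, N k m := by
  have h1 : ∀ k, B ≤ ∑ m, N k m := by
    intro k
    refine (h k).trans ?_
    rw [← Finset.sum_pair hne]
    exact Finset.sum_le_sum_of_subset_of_nonneg (Finset.subset_univ _) fun m _ _ => hN k m
  have h2 : (Fintype.card α : ℝ) * B ≤ ∑ m, N k0 m + ∑ m, N m0 m := by
    rw [← Finset.sum_add_distrib, ← nsmul_eq_mul]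
    exact Finset.card_nsmul_le_sum _ _ _ fun k _ => h' k
  have h3 : (((Finset.univ \ {k0, m0} : Finset α).card : ℕ) : ℝ) * B
      ≤ ∑ k ∈ Finset.univ \ {k0, m0}, ∑ m, N k m := by
    rw [← nsmul_eq_mul]
    exact Finset.card_nsmul_le_sum _ _ _ fun k _ => h1 k
  have hc : (((Finset.univ \ {k0, m0} : Finset α).card : ℕ) : ℝ) + 2 = Fintype.card α := by
    have := Finset.card_sdiff_add_card_eq_card (Finset.subset_univ ({k0, m0} : Finset α))
    rw [Finset.card_pair hne] at this
    exact_mod_cast this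
  rw [← Finset.sum_sdiff (Finset.subset_univ ({k0, m0} : Finset α)), Finset.sum_pair hne]
  have : (((Finset.univ \ {k0, m0} : Finset α).card : ℕ) : ℝ) = Fintype.card α - 2 := by linarith
  rw [this] at h3
  linarith

end HamAux

open HamAux

theorem stmt15 (q n d₀ : ℕ) [NeZero q] (hq : 3 ≤ q) (hd₀ : 1 ≤ d₀)
    (hdn : 2 * d₀ ≤ n + 1)
    (C : Finset (Fin n → ZMod q)) (hC1 : C.Nonempty) (hC2 : Cᶜ.Nonempty)
    (a b c d : ℕ)
    (ha : ∀ x ∈ C, (C.filter (fun y => hammingDist x y = 1)).card = a)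
    (hb : ∀ x ∈ C, (Cᶜ.filter (fun y => hammingDist x y = 1)).card = b)
    (hc : ∀ x ∈ Cᶜ, (C.filter (fun y => hammingDist x y = 1)).card = c)
    (hd : ∀ x ∈ Cᶜ, (Cᶜ.filter (fun y => hammingDist x y = 1)).card = d)
    (heig : (a : ℤ) - c = (n : ℤ) * (q - 1) - q * d₀) :
    ((univ.filter (fun i : Fin n => ∃ x y : Fin n → ZMod q,
        (∀ j, j ≠ i → x j = y j) ∧ x ∈ C ∧ y ∉ C)).card : ℝ)
      ≤ (d₀ : ℝ) / 2 * (q : ℝ) ^ (2 * d₀) / (2 ^ d₀ * ((q : ℝ) - 1) ^ d₀) := by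
  obtain ⟨n, rfl⟩ : ∃ m, n = m + 1 := ⟨n - 1, by omega⟩
  obtain ⟨e, rfl⟩ : ∃ m, d₀ = m + 1 := ⟨d₀ - 1, by omega⟩
  have hq0 : (0 : ℝ) < q := q_pos
  have hq3 : (3 : ℝ) ≤ q := by exact_mod_cast hq
  set f : (Fin (n + 1) → ZMod q) → ℝ := fun x => if x ∈ C then 1 else 0 with hf
  have hnb : ∀ x, ∑ y ∈ univ.filter (fun y => hammingDist x y = 1), f y
      = (C.filter (fun y => hammingDist x y = 1)).card := by
    intro x
    rw [hf, Finset.sum_ite_mem, Finset.sum_const, nsmul_eq_mul, mul_one]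
    congr 2
    ext y
    simp [and_comm]
  have heig' : (a : ℝ) - c = ((n + 1 : ℕ) : ℝ) * (q - 1) - q * ((e + 1 : ℕ) : ℝ) := by
    exact_mod_cast heig
  have hlap : ∀ x, lap q (n + 1) f x = q * ((e + 1 : ℕ) : ℝ) * f x - c := by
    intro x
    rw [lap_eq, hnb]
    by_cases hx : x ∈ C
    · rw [ha x hx]; simp only [hf, hx, if_true]; linarith
    · rw [hc x (by simpa using hx)]; simp [hf, hx]
  have hU : ∀ r k m, U q n (Finset.Icc (e : ℤ) (e : ℤ)) (slice q n r k f - slice q n r m f) := by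
    intro r k m
    have h1 := congrArg₂ (· - ·) (slice_lap n r k f) (slice_lap n r m f)
    have h2 : lap q n (slice q n r k f - slice q n r m f)
        = ((q : ℝ) * e) • (slice q n r k f - slice q n r m f) := by
      funext y
      have h3 := congrFun h1 y
      simp only [Pi.sub_apply, Pi.add_apply, Pi.smul_apply, smul_eq_mul, slice_apply, hlap,
        map_sub] at h3 ⊢
      push_cast at h3
      linarith
    unfold U P
    rw [Finset.Icc_self, Finset.prod_singleton]
    simp only [map_sub, Polynomial.aeval_X, Polynomial.aeval_C, LinearMap.sub_apply,
      Module.algebraMap_end_apply] at h2 ⊢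
    simp only [Int.cast_natCast]
    rw [smul_sub] at h2
    rw [← sub_eq_zero] at h2
    rw [← h2]
    abel
  have hS : ∀ r k m, ∑ y, (f (Fin.insertNth r k y) - f (Fin.insertNth r m y)) ^ 2
      = S (slice q n r k f - slice q n r m f) := by
    intro r k m
    unfold S
    refine Finset.sum_congr rfl fun y _ => ?_
    simp only [Pi.sub_apply, slice_apply, hf]
    split_ifs <;> simp_all
  set B : ℝ := 2 ^ e * ((q : ℝ) - 1) ^ e * (q : ℝ) ^ n / q ^ (e + e) with hB
  have hqp : (0 : ℝ) < q ^ (e + e) := by positivity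
  have hq1 : (0 : ℝ) < q - 1 := by linarith
  have hBm : B * q ^ (e + e) = 2 ^ e * ((q : ℝ) - 1) ^ e * (q : ℝ) ^ n :=
    div_mul_cancel₀ _ hqp.ne'
  have hBle : ∀ r k m, slice q n r k f ≠ slice q n r m f →
      B ≤ S (slice q n r k f - slice q n r m f) := by
    intro r k m hne
    have := min_supp (by omega) n e e (by omega) _ (hU r k m) (sub_ne_zero.2 hne)
    rw [← hBm] at this
    exact le_of_mul_le_mul_right this hqp
  set R := univ.filter (fun i : Fin (n + 1) => ∃ x y : Fin (n + 1) → ZMod q,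
        (∀ j, j ≠ i → x j = y j) ∧ x ∈ C ∧ y ∉ C) with hR
  have hrel : ∀ r ∈ R, 2 * ((q : ℝ) - 1) * B
      ≤ ∑ k, ∑ m, S (slice q n r k f - slice q n r m f) := by
    intro r hr
    simp only [hR, Finset.mem_filter, Finset.mem_univ, true_and] at hr
    obtain ⟨x, y, hxy, hx, hy⟩ := hr
    have hne : slice q n r (x r) f ≠ slice q n r (y r) f := by
      intro h
      have h1 := congrFun h (r.removeNth x)
      have h2 : r.removeNth x = r.removeNth y := by
        funext j
        exact hxy _ (Fin.succAbove_ne r j)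
      rw [slice_apply, slice_apply, Fin.insertNth_self_removeNth, h2,
        Fin.insertNth_self_removeNth] at h1
      simp [hf, hx, hy] at h1
    have := pair_count (fun k m => S (slice q n r k f - slice q n r m f)) B
      (fun k m => S_nonneg _) (x r) (y r) (fun h => hne (by rw [h]))
      (by
        intro k
        by_cases h : slice q n r k f = slice q n r (x r) f
        · have := hBle r k (y r) (by rw [h]; exact hne)
          have h0 := S_nonneg (slice q n r k f - slice q n r (x r) f)
          linarith
        · have := hBle r k (x r) h
          have h0 := S_nonneg (slice q n r k f - slice q n r (y r) f)
          linarith)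
      (by
        intro k
        by_cases h : slice q n r (x r) f = slice q n r k f
        · have := hBle r (y r) k (by rw [← h]; exact hne.symm)
          have h0 := S_nonneg (slice q n r (x r) f - slice q n r k f)
          linarith
        · have := hBle r (x r) k h
          have h0 := S_nonneg (slice q n r (y r) f - slice q n r k f)
          linarith)
    rwa [ZMod.card] at this
  have htot : (R.card : ℝ) * (2 * ((q : ℝ) - 1) * B) ≤ 2 * ∑ x, f x * lap q (n + 1) f x := by
    rw [← dirichlet, ← nsmul_eq_mul]
    simp only [hS]
    refine (Finset.card_nsmul_le_sum _ _ _ hrel).trans ?_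
    exact Finset.sum_le_sum_of_subset_of_nonneg (Finset.subset_univ _) fun r _ _ =>
      Finset.sum_nonneg fun k _ => Finset.sum_nonneg fun m _ => S_nonneg _
  have hsumf : ∑ x, f x = C.card := by simp [hf]
  have hs0 : (q : ℝ) * ((e + 1 : ℕ) : ℝ) * C.card = c * q ^ (n + 1) := by
    have h := sum_lap (q := q) f
    simp only [hlap, Finset.sum_sub_distrib] at h
    rw [← Finset.mul_sum, hsumf, Finset.sum_const, Finset.card_univ, Fintype.card_fun,
      ZMod.card, Fintype.card_fin, nsmul_eq_mul] at h
    push_cast at h ⊢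
    linarith
  have hen : ∑ x, f x * lap q (n + 1) f x = (q * ((e + 1 : ℕ) : ℝ) - c) * C.card := by
    rw [← hsumf, Finset.mul_sum]
    refine Finset.sum_congr rfl fun x _ => ?_
    rw [hlap]
    by_cases hx : x ∈ C <;> simp [hf, hx]
  rw [hen] at htot
  have hqn : (0 : ℝ) < q ^ (n + 1) := by positivity
  -- energy bound
  have hE : (q * ((e + 1 : ℕ) : ℝ) - c) * C.card ≤ q * ((e + 1 : ℕ) : ℝ) * q ^ (n + 1) / 4 := by
    set D : ℝ := q * ((e + 1 : ℕ) : ℝ) with hD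
    set M : ℝ := (q : ℝ) ^ (n + 1) with hM
    have hD0 : 0 ≤ D := by positivity
    refine le_of_mul_le_mul_right ?_ hqn
    have : (D - c) * C.card * M = D * (C.card * M - C.card ^ 2) := by
      linear_combination (C.card : ℝ) * hs0
    rw [this]
    nlinarith [mul_nonneg hD0 (sq_nonneg ((C.card : ℝ) - M / 2))]
  rw [le_div_iff₀ (by positivity)]
  have hfin : (R.card : ℝ) * (2 * ((q : ℝ) - 1) * B)
      ≤ 2 * (q * ((e + 1 : ℕ) : ℝ) * q ^ (n + 1) / 4) := by linarith
  have hqn' : (0 : ℝ) < q ^ n := by positivity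
  refine le_of_mul_le_mul_right ?_ hqn'
  calc (R.card : ℝ) * (2 ^ (e + 1) * ((q : ℝ) - 1) ^ (e + 1)) * q ^ n
      = R.card * (2 * ((q : ℝ) - 1) * (2 ^ e * ((q : ℝ) - 1) ^ e * (q : ℝ) ^ n)) := by ring
    _ = R.card * (2 * ((q : ℝ) - 1) * B) * q ^ (e + e) := by rw [← hBm]; ring
    _ ≤ 2 * (q * ((e + 1 : ℕ) : ℝ) * q ^ (n + 1) / 4) * q ^ (e + e) := by gcongr
    _ = _ := by ring
end
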